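/- Suppose q belongs to V but not to the closure of U. Then: (i) the sets U_q and V_q are closed subsets of ℝ; and (ii) the set V_q ∖ U_q is countably infinite, every element of V_q ∖ U_q is an isolated point of V_q, and V_q ∖ U_q is dense in V_q. -/

import Mathlib

open Classical

noncomputable section

/-- The largest digit in base `q`: `α₁ = ⌈q⌉ - 1`. -/
def alphaOne (q : ℝ) : ℕ := (⌈q⌉ - 1).toNat

/-- `c` (0-indexed: `c i` is the digit `c_{i+1}` of the paper) is an expansion of `x`
in base `q`: all digits lie in `{0, …, α₁}` and `x = ∑_{i≥1} c_i q^{-i}`. -/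
def IsExpansionOf (q x : ℝ) (c : ℕ → ℕ) : Prop :=
  (∀ i, c i ≤ alphaOne q) ∧ x = ∑' i, (c i : ℝ) / q ^ (i + 1)

/-- A sequence is called infinite if it has infinitely many nonzero terms. -/
def InfiniteSeq (c : ℕ → ℕ) : Prop := {i | c i ≠ 0}.Infinite

/-- Strict lexicographic order on sequences. -/
def LexLt (a b : ℕ → ℕ) : Prop := ∃ n, (∀ i, i < n → a i = b i) ∧ a n < b n

/-- Lexicographic order `≤` on sequences. -/
def LexLe (a b : ℕ → ℕ) : Prop := LexLt a b ∨ a = b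

/-- `b` is the greedy (lexicographically largest) expansion of `x` in base `q`. -/
def IsGreedyOf (q x : ℝ) (b : ℕ → ℕ) : Prop :=
  IsExpansionOf q x b ∧ ∀ c, IsExpansionOf q x c → LexLe c b

/-- `a` is the quasi-greedy (lexicographically largest infinite) expansion of `x`
in base `q`. -/
def IsQuasiGreedyOf (q x : ℝ) (a : ℕ → ℕ) : Prop :=
  IsExpansionOf q x a ∧ InfiniteSeq a ∧
    ∀ c, IsExpansionOf q x c → InfiniteSeq c → LexLe c a

/-- The quasi-greedy expansion of `x` in base `q`; by convention it is the zero
sequence whenever no infinite expansion exists (in particular for `x = 0`). -/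
def quasiGreedy (q x : ℝ) : ℕ → ℕ :=
  if h : ∃ a, IsQuasiGreedyOf q x a then h.choose else fun _ => 0

/-- The greedy expansion of `x` in base `q` (zero sequence if `x` has no expansion). -/
def greedy (q x : ℝ) : ℕ → ℕ :=
  if h : ∃ b, IsGreedyOf q x b then h.choose else fun _ => 0

/-- The interval `J_q = [0, α₁/(q-1)]`. -/
def Jq (q : ℝ) : Set ℝ := Set.Icc 0 ((alphaOne q : ℝ) / (q - 1))

/-- `U_q`: the set of real numbers having exactly one expansion in base `q`. -/
def Uq (q : ℝ) : Set ℝ := {x | ∃! c, IsExpansionOf q x c}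

/-- `U_q'`: the set of univoque sequences in base `q`. -/
def UqSeq (q : ℝ) : Set (ℕ → ℕ) := {c | ∃ x ∈ Uq q, IsExpansionOf q x c}

/-- `U`: the set of univoque numbers. -/
def USet : Set ℝ := {q | 1 < q ∧ ∃! c, IsExpansionOf q 1 c}

/-- `V_q`: the set of `x ∈ J_q` such that for every `n ≥ 1` with `a_n(x) > 0` the
conjugated shifted quasi-greedy expansion is lexicographically at most `(α_i)`. -/
def Vq (q : ℝ) : Set ℝ :=
  {x | x ∈ Jq q ∧ ∀ n, 0 < quasiGreedy q x n →
    LexLe (fun i => alphaOne q - quasiGreedy q x (n + 1 + i)) (quasiGreedy q 1)}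

/-- `V`: the set of `q > 1` whose quasi-greedy expansion `(α_i)` of `1` satisfies
`(α₁ - α_{k+i})_{i≥1} ≤ (α_i)_{i≥1}` lexicographically for all `k ≥ 1`. -/
def VSet : Set ℝ :=
  {q | 1 < q ∧ ∀ k, LexLe (fun i => alphaOne q - quasiGreedy q 1 (k + 1 + i)) (quasiGreedy q 1)}

/-! ### Shifts, conjugates and the lexicographic order -/

/-- The sequence obtained by dropping the first `n` terms. -/
def shiftSeq (n : ℕ) (c : ℕ → ℕ) : ℕ → ℕ := fun i => c (n + i)

/-- The digitwise conjugate `a - c i`. -/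
def conjSeq (a : ℕ) (c : ℕ → ℕ) : ℕ → ℕ := fun i => a - c i

/-- The value `∑ c_i q^{-i}` of a digit sequence. -/
def seqVal (q : ℝ) (c : ℕ → ℕ) : ℝ := ∑' i, (c i : ℝ) / q ^ (i + 1)

@[simp] lemma shiftSeq_apply (n : ℕ) (c : ℕ → ℕ) (i : ℕ) : shiftSeq n c i = c (n + i) := rfl

@[simp] lemma conjSeq_apply (a : ℕ) (c : ℕ → ℕ) (i : ℕ) : conjSeq a c i = a - c i := rfl

@[simp] lemma shiftSeq_zero (c : ℕ → ℕ) : shiftSeq 0 c = c := by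
  ext i; simp

@[simp] lemma shiftSeq_shiftSeq (m n : ℕ) (c : ℕ → ℕ) :
    shiftSeq m (shiftSeq n c) = shiftSeq (n + m) c := by
  ext i; simp [add_assoc]

lemma shiftSeq_conjSeq (a n : ℕ) (c : ℕ → ℕ) :
    shiftSeq n (conjSeq a c) = conjSeq a (shiftSeq n c) := rfl

lemma conjSeq_conjSeq {a : ℕ} {c : ℕ → ℕ} (hc : ∀ i, c i ≤ a) :
    conjSeq a (conjSeq a c) = c := by
  ext i
  have := hc i
  simp only [conjSeq_apply]
  omega

lemma lexLt_trichotomy (b c : ℕ → ℕ) : LexLt b c ∨ b = c ∨ LexLt c b := by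
  by_cases h : ∃ n, b n ≠ c n
  · have h1 := Nat.find_spec h
    have h2 : ∀ i, i < Nat.find h → b i = c i := fun i hi => by
      simpa using Nat.find_min h hi
    rcases lt_or_gt_of_ne h1 with h3 | h3
    · exact Or.inl ⟨_, h2, h3⟩
    · exact Or.inr (Or.inr ⟨_, fun i hi => (h2 i hi).symm, h3⟩)
  · push Not at h
    exact Or.inr (Or.inl (funext h))

lemma LexLt.asymm {b c : ℕ → ℕ} (h : LexLt b c) : ¬ LexLt c b := by
  rintro ⟨m, hm, hm'⟩
  obtain ⟨n, hn, hn'⟩ := h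
  rcases lt_trichotomy n m with h | h | h
  · have := hm n h; omega
  · subst h; omega
  · have := hn m h; omega

lemma lexLt_irrefl (b : ℕ → ℕ) : ¬ LexLt b b := fun h => h.asymm h

lemma LexLe.refl (b : ℕ → ℕ) : LexLe b b := Or.inr rfl

lemma LexLe.not_lexLt {b c : ℕ → ℕ} (h : LexLe b c) : ¬ LexLt c b := by
  rcases h with h | rfl
  · exact h.asymm
  · exact lexLt_irrefl _

lemma LexLe.antisymm {b c : ℕ → ℕ} (h : LexLe b c) (h' : LexLe c b) : b = c := by
  rcases h' with h' | h'
  · exact absurd h' h.not_lexLt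
  · exact h'.symm

lemma lexLe_of_not_lexLt {b c : ℕ → ℕ} (h : ¬ LexLt c b) : LexLe b c := by
  rcases lexLt_trichotomy b c with h' | h' | h'
  · exact Or.inl h'
  · exact Or.inr h'
  · exact absurd h' h

lemma LexLe.trans {b c d : ℕ → ℕ} (h : LexLe b c) (h' : LexLe c d) : LexLe b d := by
  rcases h with ⟨n, hn, hn'⟩ | rfl
  · rcases h' with ⟨m, hm, hm'⟩ | rfl
    · left
      rcases lt_trichotomy n m with h | h | h
      · exact ⟨n, fun i hi => (hn i hi).trans (hm i (hi.trans h)), by rw [← hm n h]; exact hn'⟩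
      · subst h
        exact ⟨n, fun i hi => (hn i hi).trans (hm i hi), hn'.trans hm'⟩
      · exact ⟨m, fun i hi => (hn i (hi.trans h)).trans (hm i hi), by rw [hn m h]; exact hm'⟩
    · exact Or.inl ⟨n, hn, hn'⟩
  · exact h'

/-- Two lexicographically ordered sequences with a common prefix have ordered tails. -/
lemma LexLe.shiftSeq {b c : ℕ → ℕ} (h : LexLe b c) {n : ℕ} (hn : ∀ i, i < n → b i = c i) :
    LexLe (shiftSeq n b) (shiftSeq n c) := by
  rcases h with ⟨m, hm, hm'⟩ | rfl
  · left
    have : n ≤ m := by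
      by_contra! h
      have := hn m h
      omega
    obtain ⟨k, rfl⟩ := Nat.exists_eq_add_of_le this
    exact ⟨k, fun i hi => hm _ (by omega), hm'⟩
  · exact LexLe.refl _

lemma LexLe.of_shiftSeq {b c : ℕ → ℕ} {n : ℕ} (hn : ∀ i, i < n → b i = c i)
    (h : LexLe (_root_.shiftSeq n b) (_root_.shiftSeq n c)) : LexLe b c := by
  rcases h with ⟨m, hm, hm'⟩ | h
  · refine Or.inl ⟨n + m, fun i hi => ?_, hm'⟩
    by_cases h : i < n
    · exact hn i h
    · obtain ⟨k, rfl⟩ := Nat.exists_eq_add_of_le (not_lt.1 h)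
      exact hm k (by omega)
  · right
    funext i
    by_cases h' : i < n
    · exact hn i h'
    · obtain ⟨k, rfl⟩ := Nat.exists_eq_add_of_le (not_lt.1 h')
      exact congrFun h k

lemma LexLe.conjSeq {a : ℕ} {b c : ℕ → ℕ} (hc : ∀ i, c i ≤ a) (h : LexLe b c) :
    LexLe (conjSeq a c) (conjSeq a b) := by
  rcases h with ⟨n, hn, hn'⟩ | rfl
  · refine Or.inl ⟨n, fun i hi => by simp [hn i hi], ?_⟩
    have := hc n
    simp only [conjSeq_apply]
    omega
  · exact LexLe.refl _

/-- Shifting a sequence whose first term is the largest digit decreases it. -/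
lemma lexLe_of_head_eq {a : ℕ} {c : ℕ → ℕ} (hc : ∀ i, c i ≤ a) (h0 : c 0 = a) :
    LexLe (shiftSeq 1 c) c := by
  by_cases h : ∃ n, c n < a
  · have h1 := Nat.find_spec h
    have h2 : ∀ i, i < Nat.find h → c i = a := fun i hi => by
      have := Nat.find_min h hi
      have := hc i
      omega
    have h3 : Nat.find h ≠ 0 := fun h3 => by rw [h3] at h1; omega
    obtain ⟨k, hk⟩ := Nat.exists_eq_succ_of_ne_zero h3
    rw [hk] at h1 h2
    refine Or.inl ⟨k, fun i hi => ?_, ?_⟩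
    · rw [shiftSeq_apply, h2 i (by omega), h2 (1 + i) (by omega)]
    · rw [shiftSeq_apply, h2 k (by omega), add_comm]
      exact h1
  · push Not at h
    have : ∀ i, c i = a := fun i => le_antisymm (hc i) (h i)
    right
    funext i
    simp [this]

/-- If certain shifts of `c` are smaller than `α`, there are arbitrarily long prefixes of `c` in
which these strict inequalities are all visible. -/
lemma exists_prefix_lexLt {α c : ℕ → ℕ} (P : ℕ → Prop) (hα : ∀ n, LexLe (shiftSeq n α) α)
    (hc : ∀ n, P n → LexLt (shiftSeq n c) α) (m : ℕ) :
    ∃ N, m ≤ N ∧ ∀ j, j < N → P j →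
      ∃ i, j + i < N ∧ (∀ i', i' < i → c (j + i') = α i') ∧ c (j + i) < α i := by
  have hex : ∀ j, ∃ i, P j → (∀ i', i' < i → c (j + i') = α i') ∧ c (j + i) < α i := by
    intro j
    by_cases h : P j
    · obtain ⟨i, hi, hi'⟩ := hc j h
      exact ⟨i, fun _ => ⟨hi, hi'⟩⟩
    · exact ⟨0, fun h' => absurd h' h⟩
  choose f hf using hex
  by_cases hm : ∀ j, j < m → P j → j + f j < m
  · exact ⟨m, le_rfl, fun j hj hP => ⟨f j, hm j hj hP, hf j hP⟩⟩
  · push Not at hm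
    obtain ⟨j₁, hj₁, hP₁, hle⟩ := hm
    obtain ⟨j₀, hj₀, hmax⟩ := Finset.exists_max_image ((Finset.range m).filter P)
      (fun j => j + f j) ⟨j₁, by simp [hj₁, hP₁]⟩
    simp only [Finset.mem_filter, Finset.mem_range] at hj₀ hmax
    have hm0 : m ≤ j₀ + f j₀ := hle.trans (hmax j₁ ⟨hj₁, hP₁⟩)
    refine ⟨j₀ + f j₀ + 1, by omega, fun j hj hP => ?_⟩
    by_cases hjm : j < m
    · exact ⟨f j, by have := hmax j ⟨hjm, hP⟩; omega, hf j hP⟩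
    · obtain ⟨e₁, e₂⟩ := hf j₀ hj₀.2
      obtain ⟨d, rfl⟩ := Nat.exists_eq_add_of_le (show j₀ ≤ j by omega)
      obtain ⟨l, hl⟩ := Nat.exists_eq_add_of_le (show d ≤ f j₀ by omega)
      rw [hl] at e₁ e₂ hj ⊢
      have key : ∀ i', i' < l → c (j₀ + d + i') = α (d + i') := fun i' hi' => by
        rw [add_assoc]; exact e₁ _ (by omega)
      have keyl : c (j₀ + d + l) < α (d + l) := by rw [add_assoc]; exact e₂
      rcases hα d with ⟨n, hn, hn'⟩ | heq
      · by_cases hnl : n < l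
        · exact ⟨n, by omega, fun i' hi' => (key i' (by omega)).trans (hn i' hi'),
            by rw [key n hnl]; exact hn'⟩
        · refine ⟨l, by omega, fun i' hi' => (key i' hi').trans (hn i' (by omega)), ?_⟩
          rcases (not_lt.1 hnl).lt_or_eq with h | h
          · have := hn l h
            simp only [shiftSeq_apply] at this
            omega
          · subst h
            exact keyl.trans hn'
      · refine ⟨l, by omega, fun i' hi' => (key i' hi').trans (congrFun heq i'), ?_⟩
        have := congrFun heq l
        simp only [shiftSeq_apply] at this
        omega

/-! ### Values of digit sequences -/

lemma nonpos_of_le_div_pow {q y M : ℝ} (hq : 1 < q) (h : ∀ k : ℕ, y ≤ M / q ^ k) : y ≤ 0 := by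
  have h1 : Filter.Tendsto (fun k : ℕ => M / q ^ k) Filter.atTop (nhds 0) :=
    tendsto_const_nhds.div_atTop (tendsto_pow_atTop_atTop_of_one_lt hq)
  exact ge_of_tendsto' h1 h

lemma hasSum_const_digits {q : ℝ} (hq : 1 < q) (a : ℝ) :
    HasSum (fun i : ℕ => a / q ^ (i + 1)) (a / (q - 1)) := by
  have h0 : 0 < q := by linarith
  have h1 := hasSum_geometric_of_lt_one (r := q⁻¹) (by positivity) (inv_lt_one_of_one_lt₀ hq)
  have h2 := h1.mul_left (a / q)
  have h3 : q - 1 ≠ 0 := by linarith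
  have e1 : (fun i : ℕ => a / q ^ (i + 1)) = fun i : ℕ => a / q * q⁻¹ ^ i := by
    funext i
    rw [inv_pow, pow_succ]
    field_simp
  have e2 : a / (q - 1) = a / q * (1 - q⁻¹)⁻¹ := by
    have : 1 - q⁻¹ = (q - 1) / q := by field_simp
    rw [this]
    field_simp
  rw [e1, e2]
  exact h2

lemma summable_digits {q : ℝ} {a : ℕ} {c : ℕ → ℕ} (hq : 1 < q) (hc : ∀ i, c i ≤ a) :
    Summable (fun i => (c i : ℝ) / q ^ (i + 1)) := by
  have h0 : 0 < q := by linarith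
  refine Summable.of_nonneg_of_le (fun i => by positivity) (fun i => ?_)
    (hasSum_const_digits hq a).summable
  have : (c i : ℝ) ≤ a := by exact_mod_cast hc i
  gcongr

lemma seqVal_nonneg {q : ℝ} (hq : 1 < q) (c : ℕ → ℕ) : 0 ≤ seqVal q c := by
  have h0 : 0 < q := by linarith
  exact tsum_nonneg fun i => by positivity

lemma seqVal_le {q : ℝ} {a : ℕ} {c : ℕ → ℕ} (hq : 1 < q) (hc : ∀ i, c i ≤ a) :
    seqVal q c ≤ a / (q - 1) := by
  have h0 : 0 < q := by linarith
  rw [← (hasSum_const_digits hq a).tsum_eq]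
  refine (summable_digits hq hc).tsum_le_tsum (fun i => ?_) (hasSum_const_digits hq a).summable
  have : (c i : ℝ) ≤ a := by exact_mod_cast hc i
  gcongr

lemma seqVal_const {q : ℝ} (hq : 1 < q) (a : ℕ) : seqVal q (fun _ => a) = a / (q - 1) :=
  (hasSum_const_digits hq a).tsum_eq

lemma seqVal_pos {q : ℝ} {a : ℕ} {c : ℕ → ℕ} (hq : 1 < q) (hc : ∀ i, c i ≤ a) {i : ℕ}
    (hi : c i ≠ 0) : 0 < seqVal q c := by
  have h0 : 0 < q := by linarith
  have : (0 : ℝ) < c i := by exact_mod_cast Nat.pos_of_ne_zero hi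
  exact (summable_digits hq hc).tsum_pos (fun i => by positivity) i (by positivity)

lemma seqVal_conjSeq {q : ℝ} {a : ℕ} {c : ℕ → ℕ} (hq : 1 < q) (hc : ∀ i, c i ≤ a) :
    seqVal q (conjSeq a c) = a / (q - 1) - seqVal q c := by
  rw [← (hasSum_const_digits hq a).tsum_eq, seqVal, seqVal,
    ← (hasSum_const_digits hq a).summable.tsum_sub (summable_digits hq hc)]
  refine tsum_congr fun i => ?_
  rw [conjSeq_apply, Nat.cast_sub (hc i), sub_div]

lemma seqVal_eq_sum_add {q : ℝ} {a : ℕ} {c : ℕ → ℕ} (hq : 1 < q) (hc : ∀ i, c i ≤ a) (n : ℕ) :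
    seqVal q c = ∑ i ∈ Finset.range n, (c i : ℝ) / q ^ (i + 1) + seqVal q (shiftSeq n c) / q ^ n := by
  have h0 : 0 < q := by linarith
  rw [seqVal, ← (summable_digits hq hc).sum_add_tsum_nat_add n, seqVal, ← tsum_div_const]
  congr 1
  refine tsum_congr fun i => ?_
  rw [shiftSeq_apply, add_comm i n, add_right_comm, add_assoc, add_comm 1 i, pow_add, div_div,
    mul_comm (q ^ n)]

lemma seqVal_succ {q : ℝ} {a : ℕ} {c : ℕ → ℕ} (hq : 1 < q) (hc : ∀ i, c i ≤ a) :
    seqVal q c * q = c 0 + seqVal q (shiftSeq 1 c) := by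
  have h0 : 0 < q := by linarith
  rw [seqVal_eq_sum_add hq hc 1]
  simp
  field_simp

/-- The difference of two sequences agreeing before `n`, in terms of the tails from `n` on. -/
lemma seqVal_sub_of_agree {q : ℝ} {a : ℕ} {c d : ℕ → ℕ} (hq : 1 < q) (hc : ∀ i, c i ≤ a)
    (hd : ∀ i, d i ≤ a) {n : ℕ} (h : ∀ i, i < n → d i = c i) :
    seqVal q d - seqVal q c =
      (seqVal q (shiftSeq n d) - seqVal q (shiftSeq n c)) / q ^ n := by
  rw [seqVal_eq_sum_add hq hc n, seqVal_eq_sum_add hq hd n]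
  have : ∑ i ∈ Finset.range n, (d i : ℝ) / q ^ (i + 1)
      = ∑ i ∈ Finset.range n, (c i : ℝ) / q ^ (i + 1) :=
    Finset.sum_congr rfl fun i hi => by rw [h i (Finset.mem_range.1 hi)]
  rw [this]
  ring

lemma seqVal_sub_of_agree_succ {q : ℝ} {a : ℕ} {c d : ℕ → ℕ} (hq : 1 < q) (hc : ∀ i, c i ≤ a)
    (hd : ∀ i, d i ≤ a) {n : ℕ} (h : ∀ i, i < n → d i = c i) :
    (seqVal q d - seqVal q c) * q ^ (n + 1) =
      (d n + seqVal q (shiftSeq (n + 1) d)) - (c n + seqVal q (shiftSeq (n + 1) c)) := by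
  have h0 : 0 < q := by linarith
  have e1 := seqVal_succ (c := shiftSeq n c) hq fun i => hc _
  have e2 := seqVal_succ (c := shiftSeq n d) hq fun i => hd _
  simp only [shiftSeq_shiftSeq, shiftSeq_apply, add_zero] at e1 e2
  rw [seqVal_sub_of_agree hq hc hd h, ← e1, ← e2, pow_succ]
  field_simp

lemma abs_seqVal_sub_le {q : ℝ} {a : ℕ} {c d : ℕ → ℕ} (hq : 1 < q) (hc : ∀ i, c i ≤ a)
    (hd : ∀ i, d i ≤ a) {n : ℕ} (h : ∀ i, i < n → d i = c i) :
    |seqVal q d - seqVal q c| ≤ a / (q - 1) / q ^ n := by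
  have h0 : 0 < q := by linarith
  rw [seqVal_sub_of_agree hq hc hd h, abs_div, abs_of_pos (pow_pos h0 n)]
  gcongr
  have h1 := seqVal_nonneg hq (shiftSeq n c)
  have h2 := seqVal_nonneg hq (shiftSeq n d)
  have h3 := seqVal_le (c := shiftSeq n c) hq fun i => hc _
  have h4 := seqVal_le (c := shiftSeq n d) hq fun i => hd _
  rw [abs_le]
  constructor <;> linarith

/-- A remainder sequence of the expansion algorithm computes the values of the tails. -/
lemma remainder_eq_seqVal {q M : ℝ} {a : ℕ} {c : ℕ → ℕ} {r : ℕ → ℝ} (hq : 1 < q)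
    (hc : ∀ i, c i ≤ a) (hr0 : ∀ n, 0 ≤ r n) (hrM : ∀ n, r n ≤ M)
    (hr : ∀ n, r (n + 1) = q * r n - c n) (n : ℕ) : r n = seqVal q (shiftSeq n c) := by
  have h0 : 0 < q := by linarith
  have hstep : ∀ k, (r n - seqVal q (shiftSeq n c)) * q ^ k
      = r (n + k) - seqVal q (shiftSeq (n + k) c) := by
    intro k
    induction k with
    | zero => simp
    | succ k ih =>
      have e := seqVal_succ (c := shiftSeq (n + k) c) hq fun i => hc _
      simp only [shiftSeq_shiftSeq, shiftSeq_apply, add_zero] at e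
      rw [pow_succ, ← mul_assoc, ih, ← add_assoc, hr]
      linear_combination (-1 : ℝ) * e
  refine sub_eq_zero.1 (abs_nonpos_iff.1 (nonpos_of_le_div_pow (M := M + a / (q - 1)) hq fun k => ?_))
  rw [le_div_iff₀ (pow_pos h0 k), ← abs_of_pos (pow_pos h0 k), ← abs_mul, hstep k, abs_le]
  have h1 := seqVal_nonneg hq (shiftSeq (n + k) c)
  have h2 := seqVal_le (c := shiftSeq (n + k) c) hq fun i => hc _
  have h3 := hr0 (n + k)
  have h4 := hrM (n + k)
  constructor <;> linarith

lemma infiniteSeq_iff {c : ℕ → ℕ} : InfiniteSeq c ↔ ∀ n, ∃ i, n ≤ i ∧ c i ≠ 0 := by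
  rw [InfiniteSeq, ← Nat.frequently_atTop_iff_infinite, Filter.frequently_atTop]

lemma InfiniteSeq.shiftSeq {c : ℕ → ℕ} (h : InfiniteSeq c) (n : ℕ) :
    InfiniteSeq (shiftSeq n c) := by
  rw [infiniteSeq_iff] at h ⊢
  intro m
  obtain ⟨i, hi, hi'⟩ := h (n + m)
  refine ⟨i - n, by omega, ?_⟩
  rwa [shiftSeq_apply, Nat.add_sub_cancel' (by omega)]

lemma InfiniteSeq.of_shiftSeq {c : ℕ → ℕ} {n : ℕ} (h : InfiniteSeq (_root_.shiftSeq n c)) :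
    InfiniteSeq c := by
  rw [infiniteSeq_iff] at h ⊢
  intro m
  obtain ⟨i, hi, hi'⟩ := h m
  exact ⟨n + i, by omega, hi'⟩

lemma InfiniteSeq.seqVal_pos {q : ℝ} {a : ℕ} {c : ℕ → ℕ} (hq : 1 < q) (hc : ∀ i, c i ≤ a)
    (h : InfiniteSeq c) : 0 < seqVal q c := by
  obtain ⟨i, -, hi⟩ := infiniteSeq_iff.1 h 0
  exact _root_.seqVal_pos hq hc hi

/-! ### Lexicographic criteria -/

/-- Parry-type criterion: lexicographic conditions imply that the value is at most `1`. -/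
lemma seqVal_le_one {q : ℝ} {a : ℕ} {c δ : ℕ → ℕ} (hq : 1 < q) (hδ : ∀ i, δ i ≤ a)
    (hδ1 : seqVal q δ = 1) (hc : ∀ i, c i ≤ a) (hle : LexLe c δ)
    (htail : ∀ n, c n < a → LexLe (shiftSeq (n + 1) c) δ) : seqVal q c ≤ 1 := by
  have h0 : 0 < q := by linarith
  have hM : 0 ≤ (a : ℝ) / (q - 1) := div_nonneg (Nat.cast_nonneg _) (by linarith)
  have main : ∀ k : ℕ, ∀ c : ℕ → ℕ, (∀ i, c i ≤ a) → LexLe c δ →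
      (∀ n, c n < a → LexLe (shiftSeq (n + 1) c) δ) →
      seqVal q c - 1 ≤ (a : ℝ) / (q - 1) / q ^ k := by
    intro k
    induction k with
    | zero =>
      intro c hc _ _
      have := seqVal_le hq hc
      simp
      linarith
    | succ k ih =>
      rintro c hc (⟨n, hn, hn'⟩ | rfl) htail
      · have e := seqVal_sub_of_agree_succ hq hδ hc hn
        have hs := ih (shiftSeq (n + 1) c) (fun i => hc _) (htail n (hn'.trans_le (hδ n)))
          (fun m hm => by
            rw [shiftSeq_shiftSeq]
            exact htail (n + 1 + m) hm)
        have hcd : (c n : ℝ) + 1 ≤ δ n := by exact_mod_cast hn'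
        have hpos := seqVal_nonneg hq (shiftSeq (n + 1) δ)
        rw [hδ1] at e
        have h1 : (seqVal q c - 1) * q ^ (n + 1) ≤ (a : ℝ) / (q - 1) / q ^ k := by
          rw [e]; linarith
        have h2 : seqVal q c - 1 ≤ (a : ℝ) / (q - 1) / q ^ k / q ^ (n + 1) := by
          rwa [le_div_iff₀ (pow_pos h0 _)]
        refine h2.trans ?_
        rw [pow_succ q k, ← div_div _ (q ^ k) q]
        have : q ≤ q ^ (n + 1) := le_self_pow₀ hq.le (by omega)
        gcongr
      · rw [hδ1]
        simp
        positivity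
  have := nonpos_of_le_div_pow hq fun k => main k c hc hle htail
  linarith

lemma seqVal_lt_one {q : ℝ} {a : ℕ} {c δ : ℕ → ℕ} (hq : 1 < q) (hδ : ∀ i, δ i ≤ a)
    (hδ1 : seqVal q δ = 1) (hδi : InfiniteSeq δ) (hc : ∀ i, c i ≤ a) (hlt : LexLt c δ)
    (htail : ∀ n, c n < a → LexLe (shiftSeq (n + 1) c) δ) : seqVal q c < 1 := by
  have h0 : 0 < q := by linarith
  obtain ⟨n, hn, hn'⟩ := hlt
  have e := seqVal_sub_of_agree_succ hq hδ hc hn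
  have hs := seqVal_le_one (c := shiftSeq (n + 1) c) hq hδ hδ1 (fun i => hc _)
    (htail n (hn'.trans_le (hδ n)))
    (fun m hm => by
      rw [shiftSeq_shiftSeq]
      exact htail (n + 1 + m) hm)
  have hcd : (c n : ℝ) + 1 ≤ δ n := by exact_mod_cast hn'
  have hpos : 0 < seqVal q (shiftSeq (n + 1) δ) :=
    (hδi.shiftSeq (n + 1)).seqVal_pos hq fun i => hδ _
  rw [hδ1] at e
  have : (seqVal q c - 1) * q ^ (n + 1) < 0 := by rw [e]; linarith
  have := neg_of_mul_neg_left this (pow_pos h0 _).le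
  linarith

/-- `c` is a quasi-greedy expansion of `x` with digits at most `a`, described by its tails. -/
structure IsQuasi (q : ℝ) (a : ℕ) (x : ℝ) (c : ℕ → ℕ) : Prop where
  digit_le : ∀ i, c i ≤ a
  val_eq : x = seqVal q c
  infinite : InfiniteSeq c
  tail_le : ∀ n, c n < a → seqVal q (shiftSeq (n + 1) c) ≤ 1

/-- A sequence lexicographically larger than a quasi-greedy one has at least the same value. -/
lemma IsQuasi.le_seqVal {q x : ℝ} {a : ℕ} {c d : ℕ → ℕ} (hq : 1 < q) (h : IsQuasi q a x c)
    (hd : ∀ i, d i ≤ a) (hlt : LexLt c d) :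
    x ≤ seqVal q d ∧ (InfiniteSeq d → x < seqVal q d) := by
  have h0 : 0 < q := by linarith
  obtain ⟨n, hn, hn'⟩ := hlt
  have e := seqVal_sub_of_agree_succ hq h.digit_le hd fun i hi => (hn i hi).symm
  have ht := h.tail_le n (hn'.trans_le (hd n))
  have hcd : (c n : ℝ) + 1 ≤ d n := by exact_mod_cast hn'
  have hpos := seqVal_nonneg hq (shiftSeq (n + 1) d)
  rw [← h.val_eq] at e
  constructor
  · have : 0 ≤ (seqVal q d - x) * q ^ (n + 1) := by rw [e]; linarith
    have := nonneg_of_mul_nonneg_left this (pow_pos h0 _)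
    linarith
  · intro hi
    have hpos : 0 < seqVal q (shiftSeq (n + 1) d) :=
      (hi.shiftSeq (n + 1)).seqVal_pos hq fun i => hd _
    have : 0 < (seqVal q d - x) * q ^ (n + 1) := by rw [e]; linarith
    have := pos_of_mul_pos_left this (pow_pos h0 _).le
    linarith

lemma IsQuasi.lexLt_of_seqVal_lt {q x : ℝ} {a : ℕ} {c d : ℕ → ℕ} (hq : 1 < q)
    (h : IsQuasi q a x c) (hd : ∀ i, d i ≤ a) (hlt : seqVal q d < x) : LexLt d c := by
  rcases lexLt_trichotomy d c with h' | rfl | h'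
  · exact h'
  · exact absurd h.val_eq hlt.ne'
  · exact absurd (h.le_seqVal hq hd h').1 (not_le.2 hlt)

lemma IsQuasi.lexLe_of_seqVal_le {q x : ℝ} {a : ℕ} {c d : ℕ → ℕ} (hq : 1 < q)
    (h : IsQuasi q a x c) (hd : ∀ i, d i ≤ a) (hi : InfiniteSeq d) (hle : seqVal q d ≤ x) :
    LexLe d c :=
  lexLe_of_not_lexLt fun h' => absurd ((h.le_seqVal hq hd h').2 hi) (not_lt.2 hle)

/-- Prepend the first `n` terms of `c` to `d`. -/
def prefixAppend (n : ℕ) (c d : ℕ → ℕ) : ℕ → ℕ := fun i => if i < n then c i else d (i - n)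

lemma prefixAppend_of_lt {n i : ℕ} (c d : ℕ → ℕ) (h : i < n) : prefixAppend n c d i = c i :=
  if_pos h

@[simp] lemma prefixAppend_add (n i : ℕ) (c d : ℕ → ℕ) : prefixAppend n c d (n + i) = d i := by
  simp [prefixAppend]

@[simp] lemma shiftSeq_prefixAppend (n : ℕ) (c d : ℕ → ℕ) :
    shiftSeq n (prefixAppend n c d) = d := by
  funext i; simp

lemma prefixAppend_le {a n : ℕ} {c d : ℕ → ℕ} (hc : ∀ i, c i ≤ a) (hd : ∀ i, d i ≤ a) (i : ℕ) :
    prefixAppend n c d i ≤ a := by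
  unfold prefixAppend
  split_ifs
  · exact hc _
  · exact hd _

/-- Changing the `n`-th digit of an expansion from `c n` to `b` and continuing with an expansion
`d` of the corrected remainder does not change the value. -/
lemma exists_modify {q : ℝ} {a n b : ℕ} {c d : ℕ → ℕ} (hq : 1 < q) (hc : ∀ i, c i ≤ a)
    (hb : b ≤ a) (hd : ∀ i, d i ≤ a)
    (h : (b : ℝ) + seqVal q d = c n + seqVal q (shiftSeq (n + 1) c)) :
    ∃ e : ℕ → ℕ, (∀ i, e i ≤ a) ∧ seqVal q e = seqVal q c ∧ (∀ i, i < n → e i = c i) ∧ e n = b ∧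
      shiftSeq (n + 1) e = d := by
  have h0 : 0 < q := by linarith
  set e := prefixAppend (n + 1) (Function.update c n b) d with he
  have h1 : ∀ i, e i ≤ a := prefixAppend_le (fun i => by
    by_cases hi : i = n
    · subst hi; simpa using hb
    · simpa [hi] using hc i) hd
  have h2 : ∀ i, i < n → e i = c i := fun i hi => by
    rw [he, prefixAppend_of_lt _ _ (by omega)]
    simp [hi.ne]
  have h3 : e n = b := by
    rw [he, prefixAppend_of_lt _ _ (by omega)]
    simp
  have h4 : shiftSeq (n + 1) e = d := shiftSeq_prefixAppend _ _ _
  refine ⟨e, h1, ?_, h2, h3, h4⟩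
  have := seqVal_sub_of_agree_succ hq hc h1 h2
  rw [h3, h4, h, sub_self, mul_eq_zero] at this
  rcases this with h | h
  · linarith
  · exact absurd h (pow_pos h0 _).ne'

/-- Every positive element of `[0, a/(q-1)]` has a quasi-greedy expansion. -/
lemma exists_isQuasi {q x : ℝ} {a : ℕ} (hq : 1 < q) (ha : q ≤ a + 1) (hx0 : 0 < x)
    (hx : x ≤ a / (q - 1)) : ∃ c, IsQuasi q a x c := by
  have h0 : 0 < q := by linarith
  have h1 : 0 < q - 1 := by linarith
  have hM : 1 ≤ (a : ℝ) / (q - 1) := by rw [le_div_iff₀ h1]; linarith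
  let dig : ℝ → ℕ := fun r => min a (⌈q * r⌉₊ - 1)
  let r : ℕ → ℝ := fun n => Nat.rec x (fun _ r => q * r - dig r) n
  have hr : ∀ n, r (n + 1) = q * r n - dig (r n) := fun n => rfl
  have hstep : ∀ y, 0 < y → y ≤ (a : ℝ) / (q - 1) →
      0 < q * y - dig y ∧ q * y - dig y ≤ a / (q - 1) ∧ (dig y < a → q * y - dig y ≤ 1) := by
    intro y hy hy'
    have hp : 0 < q * y := mul_pos h0 hy
    have hc := Nat.ceil_pos.2 hp
    have hc1 : ((⌈q * y⌉₊ - 1 : ℕ) : ℝ) = ⌈q * y⌉₊ - 1 := by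
      rw [Nat.cast_sub hc]; simp
    have hc2 := Nat.le_ceil (q * y)
    have hc3 := Nat.ceil_lt_add_one hp.le
    rcases le_total a (⌈q * y⌉₊ - 1) with h | h
    · have hd : dig y = a := min_eq_left h
      have h' : (a : ℝ) ≤ (⌈q * y⌉₊ - 1 : ℕ) := by exact_mod_cast h
      rw [hc1] at h'
      rw [hd]
      refine ⟨by linarith, ?_, fun h => absurd h (lt_irrefl _)⟩
      rw [le_div_iff₀ h1] at hy' ⊢
      nlinarith
    · have hd : dig y = ⌈q * y⌉₊ - 1 := min_eq_right h
      rw [hd, hc1]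
      refine ⟨by linarith, by linarith, fun _ => by linarith⟩
  have hb : ∀ n, 0 < r n ∧ r n ≤ a / (q - 1) := by
    intro n
    induction n with
    | zero => exact ⟨hx0, hx⟩
    | succ n ih =>
      rw [hr]
      exact ⟨(hstep _ ih.1 ih.2).1, (hstep _ ih.1 ih.2).2.1⟩
  have hdig : ∀ i, dig (r i) ≤ a := fun i => min_le_left _ _
  have key := remainder_eq_seqVal (c := fun n => dig (r n)) hq hdig (fun n => (hb n).1.le)
    (fun n => (hb n).2) hr
  refine ⟨fun n => dig (r n), hdig, (key 0).trans (by rw [shiftSeq_zero]), infiniteSeq_iff.2 fun n => ?_,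
    fun n hn => ?_⟩
  · by_contra! hcon
    have h2 := key n
    have h3 : shiftSeq n (fun n => dig (r n)) = fun _ => 0 := by
      funext i
      exact hcon (n + i) (by omega)
    rw [h3, seqVal_const hq] at h2
    have := (hb n).1
    simp at h2
    linarith
  · rw [← key, hr]
    exact (hstep _ (hb n).1 (hb n).2).2.2 hn

/-- A sequence all of whose relevant tails (and conjugated tails) have value less than `1` is the
only expansion of its value. -/
lemma eq_of_seqVal_eq {q : ℝ} {a : ℕ} {c d : ℕ → ℕ} (hq : 1 < q) (hc : ∀ i, c i ≤ a)
    (hd : ∀ i, d i ≤ a) (h1 : ∀ n, c n < a → seqVal q (shiftSeq (n + 1) c) < 1)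
    (h2 : ∀ n, 0 < c n → seqVal q (conjSeq a (shiftSeq (n + 1) c)) < 1)
    (h : seqVal q d = seqVal q c) : d = c := by
  rcases lexLt_trichotomy d c with ⟨n, hn, hn'⟩ | h' | ⟨n, hn, hn'⟩
  · have e := seqVal_sub_of_agree_succ hq hc hd hn
    have ht := h2 n (by omega)
    rw [seqVal_conjSeq (c := shiftSeq (n + 1) c) hq fun i => hc _] at ht
    have hle := seqVal_le (c := shiftSeq (n + 1) d) hq fun i => hd _
    have hcd : (d n : ℝ) + 1 ≤ c n := by exact_mod_cast hn'
    rw [h, sub_self, zero_mul] at e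
    linarith
  · exact h'
  · have e := seqVal_sub_of_agree_succ hq hc hd fun i hi => (hn i hi).symm
    have ht := h1 n (hn'.trans_le (hd n))
    have hpos := seqVal_nonneg hq (shiftSeq (n + 1) d)
    have hcd : (c n : ℝ) + 1 ≤ d n := by exact_mod_cast hn'
    rw [h, sub_self, zero_mul] at e
    linarith

/-! ### The quasi-greedy expansion -/

lemma alphaOne_lt {q : ℝ} (hq : 1 < q) : (alphaOne q : ℝ) < q := by
  have h1 : 1 < ⌈q⌉ := by rw [Int.lt_ceil]; simpa using hq
  have h2 : ((alphaOne q : ℤ) : ℝ) = ⌈q⌉ - 1 := by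
    rw [alphaOne, Int.toNat_of_nonneg (by omega)]
    simp
  have h3 := Int.ceil_lt_add_one q
  rw [Int.cast_natCast] at h2
  linarith

lemma le_alphaOne_add_one {q : ℝ} (hq : 1 < q) : q ≤ alphaOne q + 1 := by
  have h1 : 1 < ⌈q⌉ := by rw [Int.lt_ceil]; simpa using hq
  have h2 : ((alphaOne q : ℤ) : ℝ) = ⌈q⌉ - 1 := by
    rw [alphaOne, Int.toNat_of_nonneg (by omega)]
    simp
  have h3 := Int.le_ceil q
  rw [Int.cast_natCast] at h2
  linarith

lemma alphaOne_pos {q : ℝ} (hq : 1 < q) : 0 < alphaOne q := by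
  have h1 : 1 < ⌈q⌉ := by rw [Int.lt_ceil]; simpa using hq
  rw [alphaOne]
  omega

lemma alphaOne_eq {p : ℝ} {a : ℕ} (h1 : (a : ℝ) < p) (h2 : p ≤ a + 1) : alphaOne p = a := by
  have : ⌈p⌉ = (a : ℤ) + 1 := by
    rw [Int.ceil_eq_iff]
    push_cast
    constructor <;> linarith
  rw [alphaOne, this]
  simp

lemma one_le_alphaOne_div {q : ℝ} (hq : 1 < q) : 1 ≤ (alphaOne q : ℝ) / (q - 1) := by
  rw [le_div_iff₀ (by linarith)]
  linarith [le_alphaOne_add_one hq]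

lemma IsQuasi.isQuasiGreedyOf {q x : ℝ} {c : ℕ → ℕ} (hq : 1 < q)
    (h : IsQuasi q (alphaOne q) x c) : IsQuasiGreedyOf q x c :=
  ⟨⟨h.digit_le, h.val_eq⟩, h.infinite, fun _ hd hi =>
    h.lexLe_of_seqVal_le hq hd.1 hi hd.2.ge⟩

lemma IsQuasi.quasiGreedy_eq {q x : ℝ} {c : ℕ → ℕ} (hq : 1 < q)
    (h : IsQuasi q (alphaOne q) x c) : quasiGreedy q x = c := by
  have h' := h.isQuasiGreedyOf hq
  have hex : ∃ a, IsQuasiGreedyOf q x a := ⟨c, h'⟩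
  have hs := hex.choose_spec
  rw [quasiGreedy, dif_pos hex]
  exact (h'.2.2 _ hs.1 hs.2.1).antisymm (hs.2.2 _ h'.1 h'.2.1)

lemma isQuasi_quasiGreedy {q x : ℝ} (hq : 1 < q) (hx0 : 0 < x)
    (hx : x ≤ alphaOne q / (q - 1)) : IsQuasi q (alphaOne q) x (quasiGreedy q x) := by
  obtain ⟨c, hc⟩ := exists_isQuasi hq (le_alphaOne_add_one hq) hx0 hx
  rwa [hc.quasiGreedy_eq hq]

lemma quasiGreedy_zero {q : ℝ} (hq : 1 < q) : quasiGreedy q 0 = fun _ => 0 := by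
  rw [quasiGreedy, dif_neg]
  rintro ⟨c, hc, hi, -⟩
  exact (hi.seqVal_pos hq hc.1).ne hc.2

lemma isQuasi_quasiGreedy_one {q : ℝ} (hq : 1 < q) :
    IsQuasi q (alphaOne q) 1 (quasiGreedy q 1) :=
  isQuasi_quasiGreedy hq one_pos (one_le_alphaOne_div hq)

lemma IsQuasi.head_eq {q : ℝ} {a : ℕ} {α : ℕ → ℕ} (hq : 1 < q) (ha : (a : ℝ) < q)
    (h : IsQuasi q a 1 α) : α 0 = a := by
  by_contra hne
  have hlt : α 0 < a := lt_of_le_of_ne (h.digit_le 0) hne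
  have e := seqVal_succ hq h.digit_le
  have ht := h.tail_le 0 hlt
  rw [← h.val_eq] at e
  have : (α 0 : ℝ) + 1 ≤ a := by exact_mod_cast hlt
  simp only [zero_add] at ht
  linarith

/-- All tails of the quasi-greedy expansion of `1` are lexicographically at most itself. -/
lemma IsQuasi.shiftSeq_lexLe {q : ℝ} {a : ℕ} {α : ℕ → ℕ} (hq : 1 < q) (h : IsQuasi q a 1 α)
    (n : ℕ) : LexLe (shiftSeq n α) α := by
  induction n with
  | zero => rw [shiftSeq_zero]; exact LexLe.refl _
  | succ n ih =>
    by_cases hn : α n < a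
    · exact h.lexLe_of_seqVal_le hq (fun i => h.digit_le _) (h.infinite.shiftSeq _)
        (h.tail_le n hn)
    · have h1 : shiftSeq n α 0 = a := le_antisymm (h.digit_le _) (not_lt.1 hn)
      have h2 := lexLe_of_head_eq (c := shiftSeq n α) (fun i => h.digit_le _) h1
      rw [shiftSeq_shiftSeq] at h2
      exact h2.trans ih

/-! ### Approximation by univoque numbers -/

/-- The word `u = α_0 ⋯ α_{m-1}` followed by the periodic repetition of the conjugate of `u⁻`,
where `u⁻` is `u` with its last digit decreased by one. -/
def reflectSeq (a m : ℕ) (α : ℕ → ℕ) : ℕ → ℕ := fun i =>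
  if i < m then α i else if (i - m) % m = m - 1 then a + 1 - α (m - 1) else a - α ((i - m) % m)

section reflectSeq

variable {a m : ℕ} {α : ℕ → ℕ}

lemma reflectSeq_of_lt {i : ℕ} (h : i < m) : reflectSeq a m α i = α i := if_pos h

lemma reflectSeq_block {i t r : ℕ} (hi : i = m * (t + 1) + r) (hr : r + 1 < m) :
    reflectSeq a m α i = a - α r := by
  subst hi
  have h1 : m * (t + 1) + r - m = m * t + r := by rw [mul_add, mul_one]; omega
  have h2 : ¬ m * (t + 1) + r < m := by rw [mul_add, mul_one]; omega
  rw [reflectSeq, if_neg h2, h1, Nat.mul_add_mod, Nat.mod_eq_of_lt (by omega), if_neg (by omega)]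

lemma reflectSeq_block_last {i t r : ℕ} (hi : i = m * (t + 1) + r) (hr : r + 1 = m) :
    reflectSeq a m α i = a + 1 - α (m - 1) := by
  subst hi
  have h1 : m * (t + 1) + r - m = m * t + r := by rw [mul_add, mul_one]; omega
  have h2 : ¬ m * (t + 1) + r < m := by rw [mul_add, mul_one]; omega
  rw [reflectSeq, if_neg h2, h1, Nat.mul_add_mod, Nat.mod_eq_of_lt (by omega), if_pos (by omega)]

lemma reflectSeq_le (hα : ∀ i, α i ≤ a) (hpos : 0 < α (m - 1)) (i : ℕ) :
    reflectSeq a m α i ≤ a := by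
  unfold reflectSeq
  split_ifs
  · exact hα i
  · omega
  · omega

/-- Right after a block boundary the sequence `reflectSeq` is smaller than any proper suffix
of its first block. -/
lemma reflectSeq_continue {r t : ℕ} (hα : ∀ i, α i ≤ a) (hr : 1 ≤ r) (hrm : r < m)
    (hpre : ∀ j, j < m → ∃ i, j + i < m ∧ (∀ i', i' < i → a - α (j + i') = α i') ∧
      a - α (j + i) < α i) :
    ∃ i, i < r ∧ (∀ i', i' < i →
        reflectSeq a m α (m * (t + 1) + i') = reflectSeq a m α (m - r + i')) ∧
      reflectSeq a m α (m * (t + 1) + i) < reflectSeq a m α (m - r + i) := by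
  obtain ⟨i, hi, h1, h2⟩ := hpre (m - r) (by omega)
  refine ⟨i, by omega, fun i' hi' => ?_, ?_⟩
  · rw [reflectSeq_block rfl (by omega), reflectSeq_of_lt (by omega)]
    have := h1 i' hi'
    have := hα (m - r + i')
    omega
  · rw [reflectSeq_block rfl (by omega), reflectSeq_of_lt (by omega)]
    have := hα i
    omega

/-- If the word from position `j` up to the next block boundary `m * (t + 1)` agrees with the
beginning of `reflectSeq`, then the tail at `j` is still strictly smaller. -/
lemma reflectSeq_lexLt_of_agree {j r t : ℕ} (hα : ∀ i, α i ≤ a) (hr : 1 ≤ r) (hrm : r < m)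
    (hj : j + (m - r) = m * (t + 1))
    (hpre : ∀ j, j < m → ∃ i, j + i < m ∧ (∀ i', i' < i → a - α (j + i') = α i') ∧
      a - α (j + i) < α i)
    (h : ∀ i, i < m - r → reflectSeq a m α (j + i) = reflectSeq a m α i) :
    LexLt (shiftSeq j (reflectSeq a m α)) (reflectSeq a m α) := by
  obtain ⟨i, hi, h1, h2⟩ := reflectSeq_continue (t := t) hα hr hrm hpre
  refine ⟨m - r + i, fun i' hi' => ?_, ?_⟩
  · rw [shiftSeq_apply]
    by_cases hlt : i' < m - r
    · exact h i' hlt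
    · obtain ⟨k, rfl⟩ := Nat.exists_eq_add_of_le (not_lt.1 hlt)
      rw [← add_assoc, hj]
      exact h1 k (by omega)
  · rw [shiftSeq_apply, ← add_assoc, hj]
    exact h2

lemma reflectSeq_lexLt (hα : ∀ i, α i ≤ a) (ha : 0 < a) (h0 : α 0 = a) (hm : 2 ≤ m)
    (hsh : ∀ n, LexLe (shiftSeq n α) α)
    (hpre : ∀ j, j < m → ∃ i, j + i < m ∧ (∀ i', i' < i → a - α (j + i') = α i') ∧
      a - α (j + i) < α i) {j : ℕ} (hj : 1 ≤ j) :
    LexLt (shiftSeq j (reflectSeq a m α)) (reflectSeq a m α) := by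
  have hjeq : j = m * (j / m) + j % m := (Nat.div_add_mod j m).symm
  have hrm : j % m < m := Nat.mod_lt _ (by omega)
  generalize j % m = r at hjeq hrm
  generalize j / m = t at hjeq
  rcases t with _ | t
  · simp only [mul_zero, zero_add] at hjeq
    subst hjeq
    have hag : (∀ i, i < m - j → α (j + i) = α i) →
        LexLt (shiftSeq j (reflectSeq a m α)) (reflectSeq a m α) := fun h =>
      reflectSeq_lexLt_of_agree (t := 0) hα hj hrm (by omega) hpre fun i hi => by
        rw [reflectSeq_of_lt (by omega), reflectSeq_of_lt (by omega)]
        exact h i hi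
    rcases hsh j with ⟨n, hn, hn'⟩ | heq
    · by_cases hnm : j + n < m
      · refine ⟨n, fun i hi => ?_, ?_⟩
        · rw [shiftSeq_apply, reflectSeq_of_lt (by omega), reflectSeq_of_lt (by omega)]
          exact hn i hi
        · rw [shiftSeq_apply, reflectSeq_of_lt (by omega), reflectSeq_of_lt (by omega)]
          exact hn'
      · exact hag fun i hi => hn i (by omega)
    · exact hag fun i _ => congrFun heq i
  · rcases Nat.eq_zero_or_pos r with rfl | hr
    · refine ⟨0, by simp, ?_⟩
      rw [shiftSeq_apply, reflectSeq_block (t := t) (r := 0) (by omega) (by omega),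
        reflectSeq_of_lt (by omega), h0]
      omega
    · obtain ⟨i, hi, h1, h2⟩ := hpre r hrm
      have hlast : j + (m - r) = m * (t + 1 + 1) := by
        rw [hjeq, mul_add m (t + 1) 1]; omega
      have hag : ∀ i', i' < i → reflectSeq a m α (j + i') = reflectSeq a m α i' := fun i' hi' => by
        rw [reflectSeq_block (t := t) (r := r + i') (by omega) (by omega),
          reflectSeq_of_lt (by omega)]
        exact h1 i' hi'
      by_cases hlt : reflectSeq a m α (j + i) < reflectSeq a m α i
      · exact ⟨i, hag, hlt⟩
      · have him : r + i + 1 = m := by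
          by_contra hne
          apply hlt
          rw [reflectSeq_block (t := t) (r := r + i) (by omega) (by omega),
            reflectSeq_of_lt (by omega)]
          exact h2
        have hre : m - 1 = r + i := by omega
        rw [reflectSeq_block_last (t := t) (r := r + i) (by omega) him,
          reflectSeq_of_lt (by omega), hre] at hlt
        refine reflectSeq_lexLt_of_agree hα hr hrm hlast hpre fun i' hi' => ?_
        rcases Nat.lt_or_ge i' i with h | h
        · exact hag i' h
        · obtain rfl : i' = i := by omega
          rw [reflectSeq_block_last (t := t) (r := r + i') (by omega) him,
            reflectSeq_of_lt (by omega), hre]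
          have := hα (r + i')
          omega

lemma conjSeq_reflectSeq_lexLt (hα : ∀ i, α i ≤ a) (hm : 2 ≤ m)
    (hsh : ∀ n, LexLe (shiftSeq n α) α) (hpos : 0 < α (m - 1))
    (hpre : ∀ j, j < m → ∃ i, j + i < m ∧ (∀ i', i' < i → a - α (j + i') = α i') ∧
      a - α (j + i) < α i) (j : ℕ) :
    LexLt (conjSeq a (shiftSeq j (reflectSeq a m α))) (reflectSeq a m α) := by
  have hjeq : j = m * (j / m) + j % m := (Nat.div_add_mod j m).symm
  have hrm : j % m < m := Nat.mod_lt _ (by omega)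
  generalize j % m = r at hjeq hrm
  generalize j / m = t at hjeq
  rcases t with _ | t
  · simp only [mul_zero, zero_add] at hjeq
    subst hjeq
    obtain ⟨i, hi, h1, h2⟩ := hpre j hrm
    refine ⟨i, fun i' hi' => ?_, ?_⟩
    · rw [conjSeq_apply, shiftSeq_apply, reflectSeq_of_lt (by omega), reflectSeq_of_lt (by omega)]
      exact h1 i' hi'
    · rw [conjSeq_apply, shiftSeq_apply, reflectSeq_of_lt (by omega), reflectSeq_of_lt (by omega)]
      exact h2
  · have hblock : ∀ i, r + i + 1 < m →
        conjSeq a (shiftSeq j (reflectSeq a m α)) i = α (r + i) := fun i hi => by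
      rw [conjSeq_apply, shiftSeq_apply, reflectSeq_block (t := t) (r := r + i) (by omega) hi]
      have := hα (r + i)
      omega
    have hend : (∀ i, i < m - 1 - r → α (r + i) = α i) → α (m - 1) ≤ α (m - 1 - r) →
        LexLt (conjSeq a (shiftSeq j (reflectSeq a m α))) (reflectSeq a m α) := fun h h' => by
      refine ⟨m - 1 - r, fun i hi => ?_, ?_⟩
      · rw [hblock i (by omega), reflectSeq_of_lt (by omega)]
        exact h i hi
      · rw [conjSeq_apply, shiftSeq_apply,
          reflectSeq_block_last (t := t) (r := m - 1) (by omega) (by omega),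
          reflectSeq_of_lt (by omega)]
        have := hα (m - 1)
        omega
    have hidx : r + (m - 1 - r) = m - 1 := by omega
    rcases hsh r with ⟨n, hn, hn'⟩ | heq
    · rcases lt_trichotomy n (m - 1 - r) with h | h | h
      · refine ⟨n, fun i hi => ?_, ?_⟩
        · rw [hblock i (by omega), reflectSeq_of_lt (by omega)]
          exact hn i hi
        · rw [hblock n (by omega), reflectSeq_of_lt (by omega)]
          exact hn'
      · rw [shiftSeq_apply, h, hidx] at hn'
        exact hend (fun i hi => hn i (by omega)) hn'.le
      · have := hn _ h
        rw [shiftSeq_apply, hidx] at this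
        exact hend (fun i hi => hn i (by omega)) this.le
    · have := congrFun heq (m - 1 - r)
      rw [shiftSeq_apply, hidx] at this
      exact hend (fun i _ => congrFun heq i) this.le

end reflectSeq

/-- A sequence dominating its tails and their conjugates is the unique expansion of `1` in every
base in which it represents `1`. -/
lemma mem_USet_of_seqVal_eq_one {p : ℝ} {γ : ℕ → ℕ} (hp : 1 < p) (hγ : ∀ i, γ i ≤ alphaOne p)
    (hγ1 : seqVal p γ = 1) (hi : InfiniteSeq γ) (h1 : ∀ n, LexLt (shiftSeq (n + 1) γ) γ)
    (h2 : ∀ n, LexLt (conjSeq (alphaOne p) (shiftSeq (n + 1) γ)) γ) : p ∈ USet := by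
  have hc : ∀ n i, conjSeq (alphaOne p) (shiftSeq (n + 1) γ) i ≤ alphaOne p :=
    fun n i => Nat.sub_le _ _
  refine ⟨hp, γ, ⟨hγ, hγ1.symm⟩, fun d hd => ?_⟩
  refine eq_of_seqVal_eq hp hγ hd.1 (fun n _ => ?_) (fun n _ => ?_)
    (by rw [hγ1]; exact hd.2.symm)
  · refine seqVal_lt_one hp hγ hγ1 hi (fun i => hγ _) (h1 n) fun m _ => ?_
    rw [shiftSeq_shiftSeq]
    exact Or.inl (h1 (n + 1 + m))
  · refine seqVal_lt_one hp hγ hγ1 hi (hc n) (h2 n) fun m _ => ?_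
    rw [shiftSeq_conjSeq, shiftSeq_shiftSeq]
    exact Or.inl (h2 (n + 1 + m))

lemma continuousOn_seqVal_base {p₁ p₂ : ℝ} {a : ℕ} {c : ℕ → ℕ} (hp : 1 < p₁)
    (hc : ∀ i, c i ≤ a) : ContinuousOn (fun p => seqVal p c) (Set.Icc p₁ p₂) := by
  refine continuousOn_tsum (u := fun i : ℕ => (a : ℝ) / p₁ ^ (i + 1)) (fun i => ?_)
    (hasSum_const_digits hp a).summable fun i p hp' => ?_
  · refine continuousOn_const.div (continuousOn_id.pow _) fun p hp' => ?_
    have : 0 < p := by linarith [hp'.1]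
    exact (pow_pos this _).ne'
  · have h0 : 0 < p₁ := by linarith
    have h1 : 0 < p := h0.trans_le hp'.1
    have h2 : (c i : ℝ) ≤ a := by exact_mod_cast hc i
    rw [Real.norm_of_nonneg (by positivity)]
    have := hp'.1
    gcongr

lemma seqVal_lt_of_base_lt {p q : ℝ} {a : ℕ} {c : ℕ → ℕ} (hp : 1 < p) (hpq : p < q)
    (hc : ∀ i, c i ≤ a) (h0 : c 0 ≠ 0) : seqVal q c < seqVal p c := by
  have hp0 : 0 < p := by linarith
  have hq0 : 0 < q := by linarith
  refine (summable_digits (hp.trans hpq) hc).tsum_lt_tsum (i := 0) (fun i => ?_) ?_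
    (summable_digits hp hc)
  · have := hpq.le
    gcongr
  · have : (0 : ℝ) < c 0 := by exact_mod_cast Nat.pos_of_ne_zero h0
    simp only [zero_add, pow_one]
    gcongr

lemma exists_pow_small {p y M : ℝ} (hp : 1 < p) (hy : 0 < y) :
    ∃ N : ℕ, ∀ n, N ≤ n → M / p ^ n < y := by
  have h1 : Filter.Tendsto (fun k : ℕ => M / p ^ k) Filter.atTop (nhds 0) :=
    tendsto_const_nhds.div_atTop (tendsto_pow_atTop_atTop_of_one_lt hp)
  exact Filter.eventually_atTop.1 (h1.eventually_lt_const hy)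

/-- The greatest base with a given number of digits is univoque. -/
lemma natCast_add_one_mem_USet {q : ℝ} (hq : 1 < q) (h : q = alphaOne q + 1) : q ∈ USet := by
  have hval : seqVal q (fun _ => alphaOne q) = 1 := by
    rw [seqVal_const hq, eq_sub_of_add_eq h.symm]
    exact div_self (by linarith)
  refine ⟨hq, fun _ => alphaOne q, ⟨fun _ => le_rfl, hval.symm⟩, fun d hd => ?_⟩
  refine eq_of_seqVal_eq hq (fun _ => le_rfl) hd.1 (fun n hn => absurd hn (lt_irrefl _))
    (fun n _ => ?_) (by rw [hval]; exact hd.2.symm)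
  have : conjSeq (alphaOne q) (shiftSeq (n + 1) fun _ => alphaOne q) = fun _ => 0 := by
    funext i; simp
  rw [this, seqVal_const hq]
  simp

/-- If all conjugated tails of the quasi-greedy expansion of `1` are strictly smaller than that
expansion, then `q` is a limit of univoque numbers. -/
lemma mem_closure_USet {q : ℝ} {α : ℕ → ℕ} (hq : 1 < q) (hα : IsQuasi q (alphaOne q) 1 α)
    (hlt : ∀ n, LexLt (conjSeq (alphaOne q) (shiftSeq n α)) α) : q ∈ closure USet := by
  rcases (le_alphaOne_add_one hq).eq_or_lt with heq | hqa
  · exact subset_closure (natCast_add_one_mem_USet hq heq)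
  have haq := alphaOne_lt hq
  have ha := alphaOne_pos hq
  have h0 := hα.head_eq hq haq
  have hsh := hα.shiftSeq_lexLe hq
  set a := alphaOne q with ha_def
  have ha1 : (1 : ℝ) ≤ a := by exact_mod_cast ha
  rw [Metric.mem_closure_iff]
  intro ε hε
  obtain ⟨p₁, hp₁, hp₁q⟩ := exists_between (max_lt haq (sub_lt_self q hε))
  obtain ⟨p₂, hqp₂, hp₂⟩ := exists_between (lt_min hqa (lt_add_of_pos_right q hε))
  rw [max_lt_iff] at hp₁
  rw [lt_min_iff] at hp₂
  have h1p₁ : 1 < p₁ := by linarith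
  have h1p₂ : 1 < p₂ := by linarith
  have hv₁ := seqVal_lt_of_base_lt h1p₁ hp₁q hα.digit_le (by omega)
  have hv₂ := seqVal_lt_of_base_lt hq hqp₂ hα.digit_le (by omega)
  rw [← hα.val_eq] at hv₁ hv₂
  obtain ⟨N₁, hN₁⟩ := exists_pow_small (M := a / (p₁ - 1)) h1p₁ (sub_pos.2 hv₁)
  obtain ⟨N₂, hN₂⟩ := exists_pow_small (M := a / (p₂ - 1)) h1p₂ (sub_pos.2 hv₂)
  obtain ⟨m, hm, hpre⟩ := exists_prefix_lexLt (c := conjSeq a α) (fun _ => True) hsh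
    (fun n _ => hlt n) (max 2 (max N₁ N₂))
  have hm2 : 2 ≤ m := le_trans (le_max_left _ _) hm
  have hmN : max N₁ N₂ ≤ m := le_trans (le_max_right _ _) hm
  replace hpre : ∀ j, j < m → ∃ i, j + i < m ∧ (∀ i', i' < i → a - α (j + i') = α i') ∧
      a - α (j + i) < α i := fun j hj => hpre j hj trivial
  have hpos : 0 < α (m - 1) := by
    obtain ⟨i, hi, -, h2⟩ := hpre (m - 1) (by omega)
    obtain rfl : i = 0 := by omega
    rw [h0, add_zero] at h2
    omega
  have hγle := reflectSeq_le hα.digit_le hpos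
  have hγα : ∀ i, i < m → reflectSeq a m α i = α i := fun i hi => reflectSeq_of_lt hi
  have e₁ := abs_le.1 (abs_seqVal_sub_le h1p₁ hα.digit_le hγle hγα)
  have e₂ := abs_le.1 (abs_seqVal_sub_le h1p₂ hα.digit_le hγle hγα)
  have b₁ := hN₁ m ((le_max_left _ _).trans hmN)
  have b₂ := hN₂ m ((le_max_right _ _).trans hmN)
  obtain ⟨p, hp, hpv⟩ := intermediate_value_Icc' (hp₁q.trans hqp₂).le
    (continuousOn_seqVal_base (p₂ := p₂) h1p₁ hγle) (show (1 : ℝ) ∈ Set.Icc _ _ from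
      ⟨by linarith [e₂.2], by linarith [e₁.1]⟩)
  have hpa : alphaOne p = a := alphaOne_eq (by linarith [hp.1]) (by linarith [hp.2])
  have hlow := conjSeq_reflectSeq_lexLt hα.digit_le hm2 hsh hpos hpre
  refine ⟨p, mem_USet_of_seqVal_eq_one (by linarith [hp.1]) (by rwa [hpa]) hpv ?_ (fun n =>
    reflectSeq_lexLt hα.digit_le ha h0 hm2 hsh hpre (by omega)) (fun n => by
      rw [hpa]; exact hlow (n + 1)), ?_⟩
  · refine infiniteSeq_iff.2 fun n => ⟨m * (n + 1) + (m - 1), by nlinarith, ?_⟩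
    rw [reflectSeq_block_last rfl (by omega)]
    have := hα.digit_le (m - 1)
    omega
  · rw [Real.dist_eq, abs_lt]
    constructor <;> linarith [hp.1, hp.2]

/-! ### Sequences representing the elements of `V_q` -/

/-- The quasi-greedy expansion `α` of `1` in a base `q ∈ V` for which some conjugated tail of `α`
is equal to `α`. -/
structure IsReflective (q : ℝ) (a : ℕ) (α : ℕ → ℕ) (k : ℕ) : Prop where
  one_lt : 1 < q
  eq_alphaOne : a = alphaOne q
  isQuasi : IsQuasi q a 1 α
  conj_le : ∀ n, LexLe (conjSeq a (shiftSeq n α)) α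
  pos : 0 < k
  conj_eq : conjSeq a (shiftSeq k α) = α

/-- The sequences all of whose relevant tails and conjugated tails are at most `α`. -/
def biSeqs (a : ℕ) (α : ℕ → ℕ) : Set (ℕ → ℕ) :=
  {c | (∀ i, c i ≤ a) ∧ (∀ n, c n < a → LexLe (shiftSeq (n + 1) c) α) ∧
    ∀ n, 0 < c n → LexLe (conjSeq a (shiftSeq (n + 1) c)) α}

/-- The elements of `biSeqs a α` that end with `α`. -/
def tailSeqs (a : ℕ) (α : ℕ → ℕ) : Set (ℕ → ℕ) :=
  {c | c ∈ biSeqs a α ∧ ∃ m, shiftSeq m c = α}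

/-- The sequences all of whose relevant tails and conjugated tails are smaller than `α`. -/
def strictSeqs (a : ℕ) (α : ℕ → ℕ) : Set (ℕ → ℕ) :=
  {c | (∀ i, c i ≤ a) ∧ (∀ n, c n < a → LexLt (shiftSeq (n + 1) c) α) ∧
    ∀ n, 0 < c n → LexLt (conjSeq a (shiftSeq (n + 1) c)) α}

lemma strictSeqs_subset (a : ℕ) (α : ℕ → ℕ) : strictSeqs a α ⊆ biSeqs a α :=
  fun _ hc => ⟨hc.1, fun n hn => Or.inl (hc.2.1 n hn), fun n hn => Or.inl (hc.2.2 n hn)⟩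

/-- The set of sequences smaller than `α` in the lexicographic order is closed. -/
lemma isClosed_lexLe (α : ℕ → ℕ) : IsClosed {c : ℕ → ℕ | LexLe c α} := by
  have : {c : ℕ → ℕ | LexLe c α} = (⋃ n, {c : ℕ → ℕ | (∀ i, i < n → α i = c i) ∧ α n < c n})ᶜ := by
    ext c
    simp only [Set.mem_ofPred_eq, Set.mem_compl_iff, Set.mem_iUnion]
    exact ⟨fun h => h.not_lexLt, lexLe_of_not_lexLt⟩
  rw [this, isClosed_compl_iff]
  refine isOpen_iUnion fun n => ?_
  have : {c : ℕ → ℕ | (∀ i, i < n → α i = c i) ∧ α n < c n}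
      = (⋂ i ∈ Finset.range n, (fun c : ℕ → ℕ => c i) ⁻¹' {x | α i = x})
        ∩ (fun c : ℕ → ℕ => c n) ⁻¹' {x | α n < x} := by
    ext c
    simp only [Set.mem_inter_iff, Set.mem_iInter, Finset.mem_range, Set.mem_preimage,
      Set.mem_ofPred_eq]
  rw [this]
  refine IsOpen.inter (isOpen_biInter_finset fun i _ => ?_) ?_
  · exact (isOpen_discrete _).preimage (continuous_apply i)
  · exact (isOpen_discrete _).preimage (continuous_apply n)

lemma isCompact_biSeqs (a : ℕ) (α : ℕ → ℕ) : IsCompact (biSeqs a α) := by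
  have h1 : IsCompact (Set.univ.pi fun _ : ℕ => Set.Iic a) :=
    isCompact_univ_pi fun _ => (Set.finite_Iic a).isCompact
  refine h1.of_isClosed_subset ?_ fun c hc i _ => hc.1 i
  have : biSeqs a α = (⋂ i, (fun c : ℕ → ℕ => c i) ⁻¹' Set.Iic a)
      ∩ ((⋂ n, ((fun c : ℕ → ℕ => c n) ⁻¹' {x | ¬ x < a}
          ∪ (fun c : ℕ → ℕ => shiftSeq (n + 1) c) ⁻¹' {c | LexLe c α}))
        ∩ ⋂ n, ((fun c : ℕ → ℕ => c n) ⁻¹' {x | ¬ 0 < x}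
          ∪ (fun c : ℕ → ℕ => conjSeq a (shiftSeq (n + 1) c)) ⁻¹' {c | LexLe c α})) := by
    ext c
    simp only [biSeqs, Set.mem_ofPred_eq, Set.mem_inter_iff, Set.mem_iInter, Set.mem_preimage,
      Set.mem_Iic, Set.mem_union, imp_iff_not_or]
  have hshift : ∀ n, Continuous fun c : ℕ → ℕ => shiftSeq n c := fun n =>
    continuous_pi fun i => continuous_apply (n + i)
  have hconj : Continuous fun c : ℕ → ℕ => conjSeq a c :=
    continuous_pi fun i => (continuous_of_discreteTopology (f := fun x : ℕ => a - x)).comp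
      (continuous_apply i)
  rw [this]
  refine (isClosed_iInter fun i => (isClosed_discrete _).preimage (continuous_apply i)).inter
    ((isClosed_iInter fun n => ?_).inter (isClosed_iInter fun n => ?_))
  · exact ((isClosed_discrete _).preimage (continuous_apply n)).union
      ((isClosed_lexLe α).preimage (hshift _))
  · exact ((isClosed_discrete _).preimage (continuous_apply n)).union
      ((isClosed_lexLe α).preimage (hconj.comp (hshift _)))

lemma continuousOn_seqVal {q : ℝ} {a : ℕ} (hq : 1 < q) {s : Set (ℕ → ℕ)}
    (hs : ∀ c ∈ s, ∀ i, c i ≤ a) : ContinuousOn (seqVal q) s := by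
  have h0 : 0 < q := by linarith
  refine continuousOn_tsum (u := fun i : ℕ => (a : ℝ) / q ^ (i + 1)) (fun i => ?_)
    (hasSum_const_digits hq a).summable fun i c hc => ?_
  · exact (((continuous_of_discreteTopology (f := fun x : ℕ => (x : ℝ))).comp
      (continuous_apply i)).div_const _).continuousOn
  · have h2 : (c i : ℝ) ≤ a := by exact_mod_cast hs c hc i
    rw [Real.norm_of_nonneg (by positivity)]
    gcongr

/-- There are only countably many sequences ending with `α`. -/
lemma countable_tailSeqs (a : ℕ) (α : ℕ → ℕ) : (tailSeqs a α).Countable := by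
  refine (Set.countable_range fun l : List ℕ =>
    prefixAppend l.length (fun i => l.getD i 0) α).mono ?_
  rintro c ⟨-, m, rfl⟩
  refine ⟨(List.range m).map c, ?_⟩
  funext i
  by_cases hi : i < m
  · beta_reduce
    rw [prefixAppend_of_lt _ _ (by simpa using hi)]
    simp [hi]
  · simp [prefixAppend, hi, Nat.add_sub_cancel' (not_lt.1 hi)]

namespace IsReflective

variable {q : ℝ} {a k : ℕ} {α : ℕ → ℕ}

lemma digit_le (h : IsReflective q a α k) (i : ℕ) : α i ≤ a := h.isQuasi.digit_le i

lemma base_pos (h : IsReflective q a α k) : 0 < a := by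
  rw [h.eq_alphaOne]; exact alphaOne_pos h.one_lt

lemma head_eq (h : IsReflective q a α k) : α 0 = a :=
  h.isQuasi.head_eq h.one_lt (by rw [h.eq_alphaOne]; exact alphaOne_lt h.one_lt)

lemma shift_le (h : IsReflective q a α k) (n : ℕ) : LexLe (shiftSeq n α) α :=
  h.isQuasi.shiftSeq_lexLe h.one_lt n

lemma apply_add (h : IsReflective q a α k) (i : ℕ) : α (k + i) = a - α i := by
  have h1 := congrFun h.conj_eq i
  have h2 := h.digit_le (k + i)
  simp only [conjSeq_apply, shiftSeq_apply] at h1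
  omega

lemma shift_eq (h : IsReflective q a α k) : shiftSeq k α = conjSeq a α :=
  funext h.apply_add

lemma shift_two (h : IsReflective q a α k) : shiftSeq (k + k) α = α := by
  rw [← shiftSeq_shiftSeq, h.shift_eq, shiftSeq_conjSeq, h.shift_eq, conjSeq_conjSeq h.digit_le]

lemma apply_self (h : IsReflective q a α k) : α k = 0 := by
  have := h.apply_add 0
  rw [add_zero, h.head_eq] at this
  omega

lemma pred_pos (h : IsReflective q a α k) : 0 < α (k - 1) := by
  have hk := h.pos
  have ha := h.base_pos
  by_contra hcon
  have h1 : α (k + (k - 1)) = a := by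
    rw [h.apply_add]; omega
  have h2 : shiftSeq 1 (shiftSeq (k + (k - 1)) α) = α := by
    rw [shiftSeq_shiftSeq, show k + (k - 1) + 1 = k + k by omega, h.shift_two]
  have h3 := lexLe_of_head_eq (c := shiftSeq (k + (k - 1)) α) (fun i => h.digit_le _) h1
  rw [h2] at h3
  have h4 := (h.shift_le _).antisymm h3
  rw [h4] at h2
  have h5 : ∀ i, α i = a := by
    intro i
    induction i with
    | zero => exact h.head_eq
    | succ i ih => rw [← ih, add_comm]; exact congrFun h2 i
  have := h.apply_self
  rw [h5] at this
  omega

lemma zero_mem (h : IsReflective q a α k) : (fun _ => 0) ∈ biSeqs a α :=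
  ⟨fun _ => Nat.zero_le _, fun _ _ => Or.inl ⟨0, by simp, by
    rw [h.head_eq]; exact h.base_pos⟩, fun _ hn => absurd hn (lt_irrefl _)⟩

lemma eq_zero_or_infinite (h : IsReflective q a α k) {c : ℕ → ℕ} (hc : c ∈ biSeqs a α) :
    c = (fun _ => 0) ∨ InfiniteSeq c := by
  by_cases hi : InfiniteSeq c
  · exact Or.inr hi
  left
  rw [infiniteSeq_iff] at hi
  push Not at hi
  have hs := Nat.find_spec hi
  have hmin : ∀ n, n < Nat.find hi → ¬ ∀ i, n ≤ i → c i = 0 := fun n hn => Nat.find_min hi hn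
  generalize Nat.find hi = n at hs hmin
  rcases n with _ | n
  · exact funext fun i => hs i (Nat.zero_le _)
  · exfalso
    have hn : 0 < c n := by
      rw [Nat.pos_iff_ne_zero]
      intro h0
      refine hmin n (Nat.lt_succ_self n) fun i hi => ?_
      rcases hi.eq_or_lt with rfl | hi
      · exact h0
      · exact hs i hi
    have h1 := hc.2.2 n hn
    have h2 : conjSeq a (shiftSeq (n + 1) c) = fun _ => a := by
      funext i
      simp [hs (n + 1 + i) (by omega)]
    rw [h2] at h1
    rcases h1 with ⟨m, -, hm⟩ | h1
    · exact absurd (h.digit_le m) (not_le.2 hm)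
    · have : a = α k := congrFun h1 k
      have := h.apply_self
      have := h.base_pos
      omega

lemma isQuasi_of_mem (h : IsReflective q a α k) {c : ℕ → ℕ} (hc : c ∈ biSeqs a α)
    (hi : InfiniteSeq c) : IsQuasi q a (seqVal q c) c :=
  ⟨hc.1, rfl, hi, fun n hn => seqVal_le_one h.one_lt h.digit_le h.isQuasi.val_eq.symm
    (fun _ => hc.1 _) (hc.2.1 n hn) fun m hm => by
      rw [shiftSeq_shiftSeq]; exact hc.2.1 (n + 1 + m) hm⟩

lemma quasiGreedy_seqVal (h : IsReflective q a α k) {c : ℕ → ℕ} (hc : c ∈ biSeqs a α) :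
    quasiGreedy q (seqVal q c) = c := by
  rcases h.eq_zero_or_infinite hc with rfl | hi
  · rw [seqVal_const h.one_lt]
    simpa using quasiGreedy_zero h.one_lt
  · have := h.isQuasi_of_mem hc hi
    rw [h.eq_alphaOne] at this
    exact this.quasiGreedy_eq h.one_lt

lemma injOn_seqVal (h : IsReflective q a α k) : Set.InjOn (seqVal q) (biSeqs a α) :=
  fun c hc d hd hcd => by
    rw [← h.quasiGreedy_seqVal hc, hcd, h.quasiGreedy_seqVal hd]

lemma Vq_eq_image (h : IsReflective q a α k) : Vq q = seqVal q '' biSeqs a α := by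
  have hq := h.one_lt
  have ha := h.eq_alphaOne
  have hα1 : quasiGreedy q 1 = α := by
    have := h.isQuasi
    rw [ha] at this
    exact this.quasiGreedy_eq hq
  ext x
  constructor
  · rintro ⟨hx, hx'⟩
    rw [hα1, ← ha] at hx'
    rw [Jq, ← ha] at hx
    rcases hx.1.eq_or_lt with rfl | hx0
    · exact ⟨_, h.zero_mem, by rw [seqVal_const hq]; simp⟩
    · have hquasi := isQuasi_quasiGreedy hq hx0 (by rw [← ha]; exact hx.2)
      rw [← ha] at hquasi
      refine ⟨quasiGreedy q x, ⟨hquasi.digit_le, fun n hn => ?_, hx'⟩, hquasi.val_eq.symm⟩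
      exact h.isQuasi.lexLe_of_seqVal_le hq (fun i => hquasi.digit_le _)
        (hquasi.infinite.shiftSeq _) (hquasi.tail_le n hn)
  · rintro ⟨c, hc, rfl⟩
    refine ⟨⟨seqVal_nonneg hq c, by rw [← ha]; exact seqVal_le hq hc.1⟩, ?_⟩
    rw [h.quasiGreedy_seqVal hc, hα1, ← ha]
    exact hc.2.2

/-- The unique expansion of an element of `U_q` satisfies the strict lexicographic conditions. -/
lemma mem_strictSeqs (h : IsReflective q a α k) {c : ℕ → ℕ} (hc : ∀ i, c i ≤ a)
    (huniq : ∀ d : ℕ → ℕ, (∀ i, d i ≤ a) → seqVal q d = seqVal q c → d = c) :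
    c ∈ strictSeqs a α := by
  have hq := h.one_lt
  have ha : q ≤ a + 1 := by rw [h.eq_alphaOne]; exact le_alphaOne_add_one hq
  have hex : ∀ y, 0 ≤ y → y ≤ (a : ℝ) / (q - 1) → ∃ d : ℕ → ℕ, (∀ i, d i ≤ a) ∧ y = seqVal q d := by
    intro y hy0 hy
    rcases hy0.eq_or_lt with rfl | hy0
    · exact ⟨fun _ => 0, fun _ => Nat.zero_le _, by rw [seqVal_const hq]; simp⟩
    · obtain ⟨d, hd⟩ := exists_isQuasi hq ha hy0 hy
      exact ⟨d, hd.digit_le, hd.val_eq⟩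
  refine ⟨hc, fun n hn => ?_, fun n hn => ?_⟩
  · refine h.isQuasi.lexLt_of_seqVal_lt hq (fun i => hc _) ?_
    by_contra! hle
    have hle2 := seqVal_le (c := shiftSeq (n + 1) c) hq fun i => hc _
    obtain ⟨d, hd, hdv⟩ := hex (seqVal q (shiftSeq (n + 1) c) - 1) (by linarith) (by linarith)
    obtain ⟨e, he, hev, -, hen, -⟩ := exists_modify (n := n) (b := c n + 1) hq hc hn hd
      (by rw [← hdv]; push_cast; ring)
    rw [huniq e he hev] at hen
    omega
  · refine h.isQuasi.lexLt_of_seqVal_lt hq (fun i => Nat.sub_le _ _) ?_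
    rw [seqVal_conjSeq (c := shiftSeq (n + 1) c) hq fun i => hc _]
    by_contra! hle
    have hnn := seqVal_nonneg hq (shiftSeq (n + 1) c)
    obtain ⟨d, hd, hdv⟩ := hex (seqVal q (shiftSeq (n + 1) c) + 1) (by linarith) (by linarith)
    obtain ⟨e, he, hev, -, hen, -⟩ := exists_modify (n := n) (b := c n - 1) hq hc
      ((Nat.sub_le _ _).trans (hc n)) hd (by
        rw [← hdv, Nat.cast_sub (show 1 ≤ c n from hn)]; push_cast; ring)
    rw [huniq e he hev] at hen
    omega

lemma not_mem_tailSeqs (h : IsReflective q a α k) {c : ℕ → ℕ} (hc : c ∈ strictSeqs a α) :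
    c ∉ tailSeqs a α := by
  rintro ⟨-, m, hm⟩
  have hk := h.pos
  have h1 : 0 < c (m + (k - 1)) := by
    have := congrFun hm (k - 1)
    rw [shiftSeq_apply] at this
    rw [this]
    exact h.pred_pos
  have h2 := hc.2.2 _ h1
  rw [show m + (k - 1) + 1 = m + k by omega, ← shiftSeq_shiftSeq, hm, h.conj_eq] at h2
  exact lexLt_irrefl _ h2

lemma mem_Uq (h : IsReflective q a α k) {c : ℕ → ℕ} (hc : c ∈ biSeqs a α)
    (hc' : c ∉ tailSeqs a α) : seqVal q c ∈ Uq q := by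
  have hq := h.one_lt
  have htail : ∀ m, shiftSeq m c ≠ α := fun m hm => hc' ⟨hc, m, hm⟩
  refine ⟨c, ⟨by rw [← h.eq_alphaOne]; exact hc.1, rfl⟩, fun d hd => ?_⟩
  have hd1 := hd.1
  rw [← h.eq_alphaOne] at hd1
  refine eq_of_seqVal_eq hq hc.1 hd1 (fun n hn => ?_) (fun n hn => ?_) hd.2.symm
  · refine seqVal_lt_one hq h.digit_le h.isQuasi.val_eq.symm h.isQuasi.infinite
      (fun i => hc.1 _) ((hc.2.1 n hn).resolve_right (htail _)) fun m hm => ?_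
    rw [shiftSeq_shiftSeq]
    exact hc.2.1 (n + 1 + m) hm
  · refine seqVal_lt_one hq h.digit_le h.isQuasi.val_eq.symm h.isQuasi.infinite
      (fun i => Nat.sub_le _ _) ((hc.2.2 n hn).resolve_right fun heq => ?_) fun m hm => ?_
    · refine htail (n + 1 + k) ?_
      have h1 : shiftSeq (n + 1) c = conjSeq a α := by
        rw [← heq, conjSeq_conjSeq (c := shiftSeq (n + 1) c) fun i => hc.1 _]
      rw [← shiftSeq_shiftSeq, h1, shiftSeq_conjSeq, h.conj_eq]
    · rw [shiftSeq_conjSeq, shiftSeq_shiftSeq]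
      refine hc.2.2 (n + 1 + m) ?_
      simp only [conjSeq_apply, shiftSeq_apply] at hm
      omega

lemma Uq_subset_Vq (h : IsReflective q a α k) : Uq q ⊆ Vq q := by
  rintro x ⟨c, hc, huniq⟩
  rw [h.Vq_eq_image]
  rw [IsExpansionOf, ← h.eq_alphaOne] at hc
  refine ⟨c, strictSeqs_subset a α (h.mem_strictSeqs hc.1 fun d hd hdv => huniq d ⟨?_, ?_⟩),
    hc.2.symm⟩
  · rwa [← h.eq_alphaOne]
  · rw [hc.2]; exact hdv.symm

lemma Vq_diff_Uq_eq_image (h : IsReflective q a α k) :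
    Vq q \ Uq q = seqVal q '' tailSeqs a α := by
  rw [h.Vq_eq_image]
  ext x
  constructor
  · rintro ⟨⟨c, hc, rfl⟩, hx⟩
    exact ⟨c, by_contra fun hc' => hx (h.mem_Uq hc hc'), rfl⟩
  · rintro ⟨c, hc, rfl⟩
    refine ⟨⟨c, hc.1, rfl⟩, fun hU => ?_⟩
    refine h.not_mem_tailSeqs (h.mem_strictSeqs hc.1.1 fun d hd hdv => ?_) hc
    refine hU.unique ⟨?_, hdv.symm⟩ ⟨?_, rfl⟩
    · rwa [← h.eq_alphaOne]
    · rw [← h.eq_alphaOne]; exact hc.1.1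

/-- A sequence in `biSeqs a α` ending with `α` is determined by a finite prefix. -/
lemma exists_prefix_determines (h : IsReflective q a α k) {c : ℕ → ℕ} (hc : c ∈ tailSeqs a α) :
    ∃ N, ∀ d ∈ biSeqs a α, (∀ i, i < N → d i = c i) → d = c := by
  obtain ⟨hcb, m, hm⟩ := hc
  have hk := h.pos
  have hpos := h.pred_pos
  have hcα : ∀ i, c (m + i) = α i := fun i => congrFun hm i
  refine ⟨m + k + k, fun d hd hag => ?_⟩
  have h1 : 0 < d (m + (k - 1)) := by
    rw [hag _ (by omega), hcα]
    exact hpos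
  have h2 := hd.2.2 _ h1
  rw [show m + (k - 1) + 1 = m + k by omega] at h2
  have h3 := h2.shiftSeq (n := k) fun i hi => by
    rw [conjSeq_apply, shiftSeq_apply, hag _ (by omega), add_assoc, hcα, h.apply_add]
    have := h.digit_le i
    omega
  rw [shiftSeq_conjSeq, shiftSeq_shiftSeq, h.shift_eq] at h3
  have h4 : d (m + k + (k - 1)) < a := by
    rw [hag _ (by omega), add_assoc, hcα, h.apply_add]
    have := h.base_pos
    omega
  have h5 := hd.2.1 _ h4
  rw [show m + k + (k - 1) + 1 = m + k + k by omega] at h5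
  have h6 := h3.antisymm (h5.conjSeq h.digit_le)
  have h7 : shiftSeq (m + k + k) d = α := by
    rw [← conjSeq_conjSeq (c := shiftSeq (m + k + k) d) fun i => hd.1 _, h6,
      conjSeq_conjSeq h.digit_le]
  have h8 : shiftSeq (m + k + k) c = α := by
    rw [add_assoc, ← shiftSeq_shiftSeq, hm, h.shift_two]
  funext i
  by_cases hi : i < m + k + k
  · exact hag i hi
  · obtain ⟨j, rfl⟩ := Nat.exists_eq_add_of_le (not_lt.1 hi)
    exact congrFun (h7.trans h8.symm) j

lemma prefixAppend_mem_tailSeqs (h : IsReflective q a α k) {c : ℕ → ℕ} (hc : c ∈ biSeqs a α)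
    {N : ℕ} (hN : ∀ j, j < N → (∃ n, j = n + 1 ∧ c n < a) →
      ∃ i, j + i < N ∧ (∀ i', i' < i → c (j + i') = α i') ∧ c (j + i) < α i) :
    prefixAppend N c α ∈ tailSeqs a α := by
  have hshift : ∀ t, shiftSeq (N + t) (prefixAppend N c α) = shiftSeq t α := fun t => by
    rw [← shiftSeq_shiftSeq, shiftSeq_prefixAppend]
  refine ⟨⟨prefixAppend_le hc.1 h.digit_le, fun n hn => ?_, fun n hn => ?_⟩, N,
    shiftSeq_prefixAppend _ _ _⟩
  · by_cases hnN : n + 1 < N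
    · rw [prefixAppend_of_lt _ _ (by omega)] at hn
      obtain ⟨i, hi, h1, h2⟩ := hN (n + 1) hnN ⟨n, rfl, hn⟩
      refine Or.inl ⟨i, fun i' hi' => ?_, ?_⟩
      · rw [shiftSeq_apply, prefixAppend_of_lt _ _ (by omega), h1 i' hi']
      · rw [shiftSeq_apply, prefixAppend_of_lt _ _ hi]
        exact h2
    · obtain ⟨t, ht⟩ := Nat.exists_eq_add_of_le (not_lt.1 hnN)
      rw [ht, hshift]
      exact h.shift_le t
  · by_cases hnN : n + 1 < N
    · rw [prefixAppend_of_lt _ _ (by omega)] at hn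
      obtain ⟨L, hL⟩ := Nat.exists_eq_add_of_lt hnN
      have hpre : ∀ i, i < L + 1 → conjSeq a (shiftSeq (n + 1) (prefixAppend N c α)) i
          = conjSeq a (shiftSeq (n + 1) c) i := fun i hi => by
        rw [conjSeq_apply, shiftSeq_apply, prefixAppend_of_lt _ _ (by omega)]
        rfl
      have hagree : (∀ i, i < L + 1 → conjSeq a (shiftSeq (n + 1) c) i = α i) →
          LexLe (conjSeq a (shiftSeq (n + 1) (prefixAppend N c α))) α := fun hag => by
        refine LexLe.of_shiftSeq (n := L + 1) (fun i hi => (hpre i hi).trans (hag i hi)) ?_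
        rw [shiftSeq_conjSeq, shiftSeq_shiftSeq, show n + 1 + (L + 1) = N + 0 by omega, hshift,
          shiftSeq_zero]
        have := (h.conj_le (L + 1)).conjSeq h.digit_le
        rwa [conjSeq_conjSeq (c := shiftSeq (L + 1) α) fun i => h.digit_le _] at this
      rcases hc.2.2 n hn with ⟨i, hi, hi'⟩ | heq
      · by_cases hiL : i < L + 1
        · refine Or.inl ⟨i, fun i' hi1 => (hpre i' (by omega)).trans (hi i' hi1), ?_⟩
          rwa [hpre i hiL]
        · exact hagree fun i' hi1 => hi i' (by omega)
      · exact hagree fun i _ => congrFun heq i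
    · obtain ⟨t, ht⟩ := Nat.exists_eq_add_of_le (not_lt.1 hnN)
      rw [ht, hshift]
      exact h.conj_le t

lemma infinite_tailSeqs (h : IsReflective q a α k) : (tailSeqs a α).Infinite := by
  have ha := h.base_pos
  have h0 := h.head_eq
  refine Set.infinite_of_injective_forall_mem (f := fun n => prefixAppend n (fun _ => 0) α)
    (fun m n hmn => ?_) fun n => h.prefixAppend_mem_tailSeqs h.zero_mem fun j hj _ =>
      ⟨0, hj, by simp, by rw [h0]; exact ha⟩
  have key : ∀ m n : ℕ, m < n →
      prefixAppend m (fun _ => 0) α ≠ prefixAppend n (fun _ => 0) α := fun m n hlt heq => by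
    have h1 := congrFun heq m
    rw [prefixAppend_of_lt _ _ hlt] at h1
    have h2 := prefixAppend_add m 0 (fun _ => 0) α
    rw [add_zero] at h2
    omega
  rcases lt_trichotomy m n with hlt | heq | hlt
  · exact absurd hmn (key m n hlt)
  · exact heq
  · exact absurd hmn.symm (key n m hlt)

lemma exists_tailSeqs_agree (h : IsReflective q a α k) {c : ℕ → ℕ} (hc : c ∈ biSeqs a α)
    (M : ℕ) : ∃ d ∈ tailSeqs a α, ∀ i, i < M → d i = c i := by
  by_cases hc' : c ∈ tailSeqs a α
  · exact ⟨c, hc', fun _ _ => rfl⟩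
  · obtain ⟨N, hMN, hN⟩ := exists_prefix_lexLt (c := c) (fun j => ∃ n, j = n + 1 ∧ c n < a)
      h.shift_le (by
        rintro _ ⟨n, rfl, hn⟩
        exact (hc.2.1 n hn).resolve_right fun heq => hc' ⟨hc, _, heq⟩) M
    exact ⟨_, h.prefixAppend_mem_tailSeqs hc hN, fun i hi =>
      prefixAppend_of_lt _ _ (by omega)⟩

lemma isClosed_Vq (h : IsReflective q a α k) : IsClosed (Vq q) := by
  rw [h.Vq_eq_image]
  exact ((isCompact_biSeqs a α).image_of_continuousOn
    (continuousOn_seqVal h.one_lt fun c hc => hc.1)).isClosed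

lemma not_mem_closure (h : IsReflective q a α k) {x : ℝ} (hx : x ∈ Vq q \ Uq q) :
    x ∉ closure (Vq q \ {x}) := by
  rw [h.Vq_diff_Uq_eq_image] at hx
  obtain ⟨c, hc, rfl⟩ := hx
  obtain ⟨N, hN⟩ := h.exists_prefix_determines hc
  have himage : Vq q \ {seqVal q c} = seqVal q '' (biSeqs a α \ {c}) := by
    rw [h.Vq_eq_image, h.injOn_seqVal.image_sdiff_subset (Set.singleton_subset_iff.2 hc.1),
      Set.image_singleton]
  have hdiff : biSeqs a α \ {c} =
      biSeqs a α ∩ (⋂ i ∈ Finset.range N, (fun d : ℕ → ℕ => d i) ⁻¹' {c i})ᶜ := by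
    ext d
    simp only [Set.mem_sdiff, Set.mem_singleton_iff, Set.mem_inter_iff, Set.mem_compl_iff,
      Set.mem_iInter, Finset.mem_range, Set.mem_preimage]
    refine and_congr_right fun hd => not_congr ⟨?_, hN d hd⟩
    rintro rfl i _
    rfl
  have hcomp : IsCompact (biSeqs a α \ {c}) := by
    rw [hdiff]
    refine (isCompact_biSeqs a α).inter_right (isClosed_compl_iff.2 ?_)
    exact isOpen_biInter_finset fun i _ => (isOpen_discrete _).preimage (continuous_apply i)
  have hclosed : IsClosed (Vq q \ {seqVal q c}) := by
    rw [himage]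
    exact (hcomp.image_of_continuousOn
      (continuousOn_seqVal h.one_lt fun c hc => hc.1.1)).isClosed
  rw [hclosed.closure_eq]
  simp

lemma Vq_subset_closure (h : IsReflective q a α k) : Vq q ⊆ closure (Vq q \ Uq q) := by
  intro x hx
  rw [h.Vq_eq_image] at hx
  obtain ⟨c, hc, rfl⟩ := hx
  rw [h.Vq_diff_Uq_eq_image, Metric.mem_closure_iff]
  intro ε hε
  obtain ⟨N, hN⟩ := exists_pow_small (M := (a : ℝ) / (q - 1)) h.one_lt hε
  obtain ⟨d, hd, hag⟩ := h.exists_tailSeqs_agree hc N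
  refine ⟨_, ⟨d, hd, rfl⟩, ?_⟩
  rw [dist_comm, Real.dist_eq]
  exact (abs_seqVal_sub_le h.one_lt hc.1 hd.1.1 hag).trans_lt (hN N le_rfl)

/-- Since the points of `V_q \ U_q` are isolated in the closed set `V_q`, the set `U_q` is
closed. -/
lemma isClosed_Uq (h : IsReflective q a α k) : IsClosed (Uq q) := by
  refine isClosed_of_closure_subset fun x hx => ?_
  have hxV : x ∈ Vq q := closure_minimal h.Uq_subset_Vq h.isClosed_Vq hx
  by_contra hxU
  have hsub : Uq q ⊆ Vq q \ {x} := fun y hy =>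
    ⟨h.Uq_subset_Vq hy, by rintro rfl; exact hxU hy⟩
  exact h.not_mem_closure ⟨hxV, hxU⟩ (closure_mono hsub hx)

end IsReflective

/-- The quasi-greedy expansion of `1` is reflective in every base of `V` outside the closure
of `U`. -/
lemma exists_isReflective {q : ℝ} (hq : q ∈ VSet) (h : q ∉ closure USet) :
    ∃ k, IsReflective q (alphaOne q) (quasiGreedy q 1) k := by
  obtain ⟨h1, hV⟩ := hq
  have hα := isQuasi_quasiGreedy_one h1
  have h0 := hα.head_eq h1 (alphaOne_lt h1)
  have hzero : LexLt (conjSeq (alphaOne q) (shiftSeq 0 (quasiGreedy q 1))) (quasiGreedy q 1) := by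
    refine ⟨0, by simp, ?_⟩
    rw [shiftSeq_zero, conjSeq_apply, h0, Nat.sub_self]
    exact alphaOne_pos h1
  have hle : ∀ n, LexLe (conjSeq (alphaOne q) (shiftSeq n (quasiGreedy q 1)))
      (quasiGreedy q 1) := by
    rintro (_ | n)
    · exact Or.inl hzero
    · exact hV n
  by_contra! hcon
  refine h (mem_closure_USet h1 hα fun n => (hle n).resolve_right fun heq => hcon n
    ⟨h1, rfl, hα, hle, Nat.pos_of_ne_zero ?_, heq⟩)
  rintro rfl
  rw [heq] at hzero
  exact lexLt_irrefl _ hzero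

/-- If `q ∈ V \ closure(U)`, then `U_q` and `V_q` are closed,
`V_q \ U_q` is countably infinite, consists of isolated points of `V_q`, and is
dense in `V_q`. -/
theorem Vq_structure_outside_closureU (q : ℝ) (hq : q ∈ VSet) (h : q ∉ closure USet) :
    IsClosed (Uq q) ∧ IsClosed (Vq q) ∧
      (Vq q \ Uq q).Countable ∧ (Vq q \ Uq q).Infinite ∧
      (∀ x ∈ Vq q \ Uq q, x ∉ closure (Vq q \ {x})) ∧
      Vq q ⊆ closure (Vq q \ Uq q) := by
  obtain ⟨k, hk⟩ := exists_isReflective hq h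
  refine ⟨hk.isClosed_Uq, hk.isClosed_Vq, ?_, ?_, fun x hx => hk.not_mem_closure hx,
    hk.Vq_subset_closure⟩
  · rw [hk.Vq_diff_Uq_eq_image]
    exact (countable_tailSeqs _ _).image _
  · rw [hk.Vq_diff_Uq_eq_image]
    exact hk.infinite_tailSeqs.image (hk.injOn_seqVal.mono fun _ hc => hc.1)
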